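/- Oracle PAC-Bayes bound in probability: for any λ > 0 and any ε ∈ (0,1), the Gibbs posterior ρ̂_λ with density proportional to exp(−λ r(θ)) with respect to π satisfies, with probability at least 1 − ε over the sample S: E_{θ∼ρ̂_λ}[R(θ)] ≤ inf over ρ ∈ P(Θ) of ( E_{θ∼ρ}[R(θ)] + λC²/(4n) + 2( KL(ρ‖π) + log(2/ε) ) / λ ). -/

import Mathlib

open MeasureTheory
open scoped ENNReal

/- Kullback-Leibler divergence: `∫ log (dρ/dπ) dρ` when `ρ ≪ π` (and the integral is
well-defined), `+∞` otherwise. -/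
open Classical in
noncomputable def KL {Θ : Type*} [MeasurableSpace Θ] (ρ π : Measure Θ) : ℝ≥0∞ :=
  if ρ ≪ π ∧ Integrable (fun θ => Real.log ((ρ.rnDeriv π) θ).toReal) ρ
  then ENNReal.ofReal (∫ θ, Real.log ((ρ.rnDeriv π) θ).toReal ∂ρ)
  else ⊤

/- The risk `R(θ) = E_{(X,Y)∼P}[ℓ(f_θ(X),Y)]`. -/
noncomputable def risk {X Y Θ : Type*} [MeasurableSpace X] [MeasurableSpace Y]
    (P : Measure (X × Y)) (f : Θ → X → Y) (ℓ : Y → Y → ℝ) (θ : Θ) : ℝ :=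
  ∫ p, ℓ (f θ p.1) p.2 ∂P

/- The empirical risk `r(θ) = (1/n) ∑ᵢ ℓ(f_θ(Xᵢ),Yᵢ)` on the sample `ω`. -/
noncomputable def empRisk {X Y Θ : Type*} (f : Θ → X → Y) (ℓ : Y → Y → ℝ)
    (n : ℕ) (ω : Fin n → X × Y) (θ : Θ) : ℝ :=
  (∑ i, ℓ (f θ (ω i).1) (ω i).2) / n

/- The Gibbs posterior `ρ̂_λ`, with density proportional to `exp (-λ r θ)` w.r.t. `π`. -/
noncomputable def gibbs {X Y Θ : Type*} [MeasurableSpace Θ] (π : Measure Θ)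
    (f : Θ → X → Y) (ℓ : Y → Y → ℝ) (lam : ℝ) (n : ℕ) (ω : Fin n → X × Y) : Measure Θ :=
  π.tilted (fun θ => -lam * empRisk f ℓ n ω θ)

open ProbabilityTheory

/-- Donsker-Varadhan inequality for a bounded function. -/
lemma integral_le_integral_llr_add_log_integral_exp {Θ : Type*} [MeasurableSpace Θ]
    {ρ π : Measure Θ} [IsProbabilityMeasure ρ] [IsProbabilityMeasure π] (hac : ρ ≪ π)
    (hllr : Integrable (llr ρ π) ρ) {g : Θ → ℝ} (hgρ : Integrable g ρ)
    (hgπ : Integrable (fun θ => Real.exp (g θ)) π) :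
    ∫ θ, g θ ∂ρ ≤ ∫ θ, llr ρ π θ ∂ρ + Real.log (∫ θ, Real.exp (g θ) ∂π) := by
  have : IsProbabilityMeasure (π.tilted g) := isProbabilityMeasure_tilted hgπ
  have h := InformationTheory.integral_llr_add_sub_measure_univ_nonneg
    (hac.trans (absolutelyContinuous_tilted hgπ))
    (integrable_llr_tilted_right hac hgρ hllr hgπ)
  rw [integral_llr_tilted_right hac hgρ hgπ hllr] at h
  simp at h
  linarith

/-- Gibbs posterior oracle inequality, given control of the exponential moments of the
deviations of `r` from `R` under the prior. -/
lemma integral_tilted_le_of_log_integral_exp_le {Θ : Type*} [MeasurableSpace Θ]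
    {ρ π : Measure Θ} [IsProbabilityMeasure ρ] [IsProbabilityMeasure π] (hac : ρ ≪ π)
    (hllr : Integrable (llr ρ π) ρ) {R r : Θ → ℝ} {C lam B : ℝ}
    (hR : Measurable R) (hr : Measurable r) (hR' : ∀ θ, |R θ| ≤ C) (hr' : ∀ θ, |r θ| ≤ C)
    (h₁ : Real.log (∫ θ, Real.exp (lam * (R θ - r θ)) ∂π) ≤ B)
    (h₂ : Real.log (∫ θ, Real.exp (-lam * (R θ - r θ)) ∂π) ≤ B) :
    lam * ∫ θ, R θ ∂(π.tilted fun θ => -lam * r θ) ≤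
      lam * ∫ θ, R θ ∂ρ + 2 * ∫ θ, llr ρ π θ ∂ρ + 2 * B := by
  have bdd {ν : Measure Θ} [IsProbabilityMeasure ν] {g : Θ → ℝ} (hg : Measurable g)
      (hb : ∀ θ, |g θ| ≤ |lam| * (2 * C)) :
      Integrable g ν ∧ Integrable (fun θ => Real.exp (g θ)) ν := by
    refine ⟨.of_bound hg.aestronglyMeasurable _ (ae_of_all _ hb),
      .of_bound (C := Real.exp (|lam| * (2 * C))) hg.exp.aestronglyMeasurable
        (ae_of_all _ fun θ => ?_)⟩
    rw [Real.norm_eq_abs, Real.abs_exp]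
    exact Real.exp_le_exp.2 ((le_abs_self _).trans (hb θ))
  have hC (θ : Θ) : 0 ≤ C := (abs_nonneg _).trans (hR' θ)
  have bR (θ : Θ) : |lam * R θ| ≤ |lam| * (2 * C) := by
    rw [abs_mul]
    exact mul_le_mul_of_nonneg_left (by linarith [hR' θ, hC θ]) (abs_nonneg _)
  have br (θ : Θ) : |-lam * r θ| ≤ |lam| * (2 * C) := by
    rw [abs_mul, abs_neg]
    exact mul_le_mul_of_nonneg_left (by linarith [hr' θ, hC θ]) (abs_nonneg _)
  have bd (θ : Θ) : |-lam * (R θ - r θ)| ≤ |lam| * (2 * C) := by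
    rw [abs_mul, abs_neg]
    exact mul_le_mul_of_nonneg_left (by linarith [hR' θ, hr' θ, abs_sub (R θ) (r θ)])
      (abs_nonneg _)
  have mR : Measurable fun θ => lam * R θ := hR.const_mul _
  have mr : Measurable fun θ => -lam * r θ := hr.const_mul _
  have md : Measurable fun θ => -lam * (R θ - r θ) := (hR.sub hr).const_mul _
  have hπr := (bdd (ν := π) mr br).2
  have : IsProbabilityMeasure (π.tilted fun θ => -lam * r θ) := isProbabilityMeasure_tilted hπr
  set ρ' := π.tilted fun θ => -lam * r θ with hρ'
  have jensen : Real.exp (∫ θ, lam * R θ ∂ρ') ≤ ∫ θ, Real.exp (lam * R θ) ∂ρ' :=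
    convexOn_exp.map_integral_le Real.continuous_exp.continuousOn isClosed_univ (by simp)
      (bdd mR bR).1 (bdd mR bR).2
  have hpos : 0 < ∫ θ, Real.exp (-lam * r θ) ∂π := integral_exp_pos hπr
  have hgibbs : lam * ∫ θ, R θ ∂ρ' ≤ B - Real.log (∫ θ, Real.exp (-lam * r θ) ∂π) := by
    have heq : ∫ θ, Real.exp (lam * R θ) ∂ρ' =
        (∫ θ, Real.exp (lam * (R θ - r θ)) ∂π) / ∫ θ, Real.exp (-lam * r θ) ∂π := by
      rw [hρ', integral_exp_tilted]
      congr 2 with θ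
      simp only [Pi.add_apply]
      ring_nf
    rw [heq, integral_const_mul] at jensen
    have hnum : (∫ θ, Real.exp (lam * (R θ - r θ)) ∂π) ≠ 0 := by
      intro h0
      rw [h0, zero_div] at jensen
      exact absurd (Real.exp_pos _) jensen.not_gt
    have h := Real.log_le_log (Real.exp_pos _) jensen
    rw [Real.log_exp, Real.log_div hnum hpos.ne'] at h
    linarith
  have dv₁ := integral_le_integral_llr_add_log_integral_exp hac hllr (bdd mr br).1 hπr
  have dv₂ := integral_le_integral_llr_add_log_integral_exp hac hllr (bdd md bd).1 (bdd md bd).2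
  rw [integral_const_mul] at dv₁ dv₂
  rw [integral_sub (.of_bound hR.aestronglyMeasurable C (ae_of_all _ hR'))
    (.of_bound hr.aestronglyMeasurable C (ae_of_all _ hr'))] at dv₂
  linarith

/-- Hoeffding's bound on the exponential moments of an empirical mean. -/
lemma lintegral_exp_mean_sub_le {Z : Type*} [MeasurableSpace Z] (P : Measure Z)
    [IsProbabilityMeasure P] {g : Z → ℝ} (hg : Measurable g) {C : ℝ}
    (hb : ∀ z, g z ∈ Set.Icc 0 C) {n : ℕ} (hn : 0 < n) (s : ℝ) :
    ∫⁻ ω, ENNReal.ofReal (Real.exp (s * (∫ z, g z ∂P - (∑ i, g (ω i)) / n)))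
      ∂(Measure.pi fun _ : Fin n => P) ≤ ENNReal.ofReal (Real.exp (s ^ 2 * C ^ 2 / (8 * n))) := by
  have hn' : (n : ℝ) ≠ 0 := by positivity
  have hsub := hasSubgaussianMGF_of_mem_Icc (μ := P) hg.aemeasurable (ae_of_all _ hb)
  have hfac (ω : Fin n → Z) : Real.exp (s * (∫ z, g z ∂P - (∑ i, g (ω i)) / n)) =
      ∏ i, Real.exp (-s / n * (g (ω i) - ∫ z, g z ∂P)) := by
    rw [← Real.exp_sum, ← Finset.mul_sum, Finset.sum_sub_distrib]
    congr 1
    simp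
    field_simp
    ring
  simp_rw [hfac]
  rw [← ofReal_integral_eq_lintegral_ofReal
    (Integrable.fintype_prod fun _ => hsub.integrable_exp_mul _)
    (ae_of_all _ fun ω => Finset.prod_nonneg fun _ _ => (Real.exp_pos _).le),
    integral_fintype_prod_eq_pow (fun z => Real.exp (-s / n * (g z - ∫ z, g z ∂P)))]
  refine ENNReal.ofReal_le_ofReal ?_
  refine (pow_le_pow_left₀ (integral_nonneg fun _ => (Real.exp_pos _).le)
    (hsub.mgf_le (-s / n)) _).trans_eq ?_
  rw [← Real.exp_nat_mul]
  congr 1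
  simp
  field_simp
  rw [sq_abs]
  ring

lemma measurable_risk {X Y Θ : Type*} [MeasurableSpace X] [MeasurableSpace Y]
    [MeasurableSpace Θ] (P : Measure (X × Y)) [IsProbabilityMeasure P] {f : Θ → X → Y}
    {ℓ : Y → Y → ℝ} (hmeas : Measurable (fun p : Θ × X × Y => ℓ (f p.1 p.2.1) p.2.2)) :
    Measurable (risk P f ℓ) :=
  hmeas.stronglyMeasurable.integral_prod_right'.measurable

lemma measurable_empRisk {X Y Θ : Type*} [MeasurableSpace X] [MeasurableSpace Y]
    [MeasurableSpace Θ] {f : Θ → X → Y} {ℓ : Y → Y → ℝ}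
    (hmeas : Measurable (fun p : Θ × X × Y => ℓ (f p.1 p.2.1) p.2.2)) (n : ℕ) :
    Measurable fun p : (Fin n → X × Y) × Θ => empRisk f ℓ n p.1 p.2 := by
  unfold empRisk
  refine (Finset.measurable_sum _ fun i _ => ?_).div_const _
  exact hmeas.comp (measurable_snd.prodMk ((measurable_pi_apply i).comp measurable_fst))

lemma risk_mem_Icc {X Y Θ : Type*} [MeasurableSpace X] [MeasurableSpace Y] (P : Measure (X × Y))
    [IsProbabilityMeasure P] (f : Θ → X → Y) {ℓ : Y → Y → ℝ} {C : ℝ}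
    (hbound : ∀ y' y : Y, ℓ y' y ∈ Set.Icc 0 C) (θ : Θ) : risk P f ℓ θ ∈ Set.Icc 0 C := by
  refine ⟨integral_nonneg fun _ => (hbound _ _).1, ?_⟩
  have hC : 0 ≤ C := by
    obtain ⟨p⟩ := P.nonempty_of_neZero
    exact (hbound p.2 p.2).1.trans (hbound p.2 p.2).2
  refine (integral_mono_of_nonneg (ae_of_all _ fun _ => (hbound _ _).1) (integrable_const C)
    (ae_of_all _ fun _ => (hbound _ _).2)).trans ?_
  simp

lemma empRisk_mem_Icc {X Y Θ : Type*} (f : Θ → X → Y) {ℓ : Y → Y → ℝ} {C : ℝ}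
    (hbound : ∀ y' y : Y, ℓ y' y ∈ Set.Icc 0 C) {n : ℕ} (hn : 0 < n) (ω : Fin n → X × Y) (θ : Θ) :
    empRisk f ℓ n ω θ ∈ Set.Icc 0 C := by
  have hn' : (0 : ℝ) < n := by exact_mod_cast hn
  refine ⟨div_nonneg (Finset.sum_nonneg fun _ _ => (hbound _ _).1) hn'.le, ?_⟩
  rw [empRisk, div_le_iff₀ hn']
  refine (Finset.sum_le_sum fun i _ => (hbound _ _).2).trans ?_
  simp [mul_comm]

/-- With probability at least `1 - ε`, both exponential moments under the prior of the deviation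
between risk and empirical risk are controlled. -/
lemma ofReal_one_sub_le_measure_lintegral_exp_deviation_le
    {X Y Θ : Type*} [MeasurableSpace X] [MeasurableSpace Y] [MeasurableSpace Θ]
    (P : Measure (X × Y)) [IsProbabilityMeasure P] {f : Θ → X → Y} {ℓ : Y → Y → ℝ} {C : ℝ}
    (hmeas : Measurable (fun p : Θ × X × Y => ℓ (f p.1 p.2.1) p.2.2))
    (hbound : ∀ y' y : Y, ℓ y' y ∈ Set.Icc 0 C)
    (π : Measure Θ) [IsProbabilityMeasure π]
    {n : ℕ} (hn : 0 < n) (lam : ℝ) {ε : ℝ} (hε : 0 < ε) :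
    ENNReal.ofReal (1 - ε) ≤ (Measure.pi fun _ : Fin n => P)
      {ω | ∀ s ∈ ({lam, -lam} : Set ℝ),
        ∫⁻ θ, ENNReal.ofReal (Real.exp (s * (risk P f ℓ θ - empRisk f ℓ n ω θ))) ∂π ≤
          ENNReal.ofReal (2 / ε * Real.exp (lam ^ 2 * C ^ 2 / (8 * n)))} := by
  set μ := Measure.pi fun _ : Fin n => P
  set M := Real.exp (lam ^ 2 * C ^ 2 / (8 * n)) with hM
  have hM0 : 0 < M := Real.exp_pos _
  let D (s : ℝ) (ω : Fin n → X × Y) : ℝ≥0∞ :=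
    ∫⁻ θ, ENNReal.ofReal (Real.exp (s * (risk P f ℓ θ - empRisk f ℓ n ω θ))) ∂π
  have hjoint (s : ℝ) : Measurable fun p : (Fin n → X × Y) × Θ =>
      ENNReal.ofReal (Real.exp (s * (risk P f ℓ p.2 - empRisk f ℓ n p.1 p.2))) :=
    ((((measurable_risk P hmeas).comp measurable_snd).sub
      (measurable_empRisk hmeas n)).const_mul s).exp.ennreal_ofReal
  have hD (s : ℝ) : Measurable (D s) := (hjoint s).lintegral_prod_right'
  have hDint (s : ℝ) (hs : s ^ 2 = lam ^ 2) : ∫⁻ ω, D s ω ∂μ ≤ ENNReal.ofReal M := by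
    rw [lintegral_lintegral_swap (hjoint s).aemeasurable]
    refine (lintegral_mono fun θ => ?_).trans_eq
      (by simp : ∫⁻ _ : Θ, ENNReal.ofReal M ∂π = ENNReal.ofReal M)
    rw [hM, ← hs]
    exact lintegral_exp_mean_sub_le P (g := fun z => ℓ (f θ z.1) z.2)
      (hmeas.comp measurable_prodMk_left) (fun _ => hbound _ _) hn s
  set T := ENNReal.ofReal (2 / ε * M) with hT
  have hT0 : T ≠ 0 := by
    rw [hT, Ne, ENNReal.ofReal_eq_zero, not_le]
    positivity
  have hmarkov : μ {ω | T ≤ D lam ω + D (-lam) ω} ≤ ENNReal.ofReal ε := by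
    refine (meas_ge_le_lintegral_div ((hD lam).add (hD (-lam))).aemeasurable hT0
      ENNReal.ofReal_ne_top).trans ?_
    simp only [Pi.add_apply]
    rw [lintegral_add_left (hD _)]
    refine (ENNReal.div_le_div_right (add_le_add (hDint _ rfl) (hDint _ (neg_sq _))) _).trans_eq ?_
    rw [← ENNReal.ofReal_add hM0.le hM0.le, hT, ← ENNReal.ofReal_div_of_pos (by positivity)]
    congr 1
    field_simp
    ring
  calc ENNReal.ofReal (1 - ε) = 1 - ENNReal.ofReal ε := by
        rw [ENNReal.ofReal_sub _ hε.le, ENNReal.ofReal_one]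
    _ ≤ 1 - μ {ω | T ≤ D lam ω + D (-lam) ω} := tsub_le_tsub_left hmarkov _
    _ = μ {ω | T ≤ D lam ω + D (-lam) ω}ᶜ :=
        (prob_compl_eq_one_sub (measurableSet_le measurable_const ((hD _).add (hD _)))).symm
    _ ≤ _ := by
        refine measure_mono fun ω hω => ?_
        have hlt : D lam ω + D (-lam) ω < T := not_le.1 hω
        rintro s (rfl | rfl)
        · exact le_self_add.trans hlt.le
        · exact le_add_self.trans hlt.le

/-- Oracle PAC-Bayes bound in probability: for any `λ > 0` and `ε ∈ (0,1)`, with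
probability at least `1 - ε` over the sample, the Gibbs posterior satisfies
`E_{θ∼ρ̂_λ}[R(θ)] ≤ inf_ρ ( E_{θ∼ρ}[R(θ)] + λC²/(4n) + 2(KL(ρ‖π) + log(2/ε))/λ )`. -/
theorem oracle_pac_bayes_bound_in_probability
    {X Y Θ : Type*} [MeasurableSpace X] [MeasurableSpace Y] [MeasurableSpace Θ]
    (P : Measure (X × Y)) [IsProbabilityMeasure P]
    (f : Θ → X → Y) (ℓ : Y → Y → ℝ) (C : ℝ) (hC : 0 < C)
    (hmeas : Measurable (fun p : Θ × X × Y => ℓ (f p.1 p.2.1) p.2.2))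
    (hbound : ∀ y' y : Y, ℓ y' y ∈ Set.Icc 0 C)
    (π : Measure Θ) [IsProbabilityMeasure π]
    (n : ℕ) (hn : 0 < n) (lam ε : ℝ) (hlam : 0 < lam) (hε : ε ∈ Set.Ioo (0:ℝ) 1) :
    ENNReal.ofReal (1 - ε) ≤
      (Measure.pi fun _ : Fin n => P)
        {ω | ∫⁻ θ, ENNReal.ofReal (risk P f ℓ θ) ∂(gibbs π f ℓ lam n ω) ≤
          ⨅ ρ : {ρ : Measure Θ // IsProbabilityMeasure ρ},
            ((∫⁻ θ, ENNReal.ofReal (risk P f ℓ θ) ∂ρ.1)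
              + ENNReal.ofReal (lam * C ^ 2 / (4 * n))
              + 2 * (KL ρ.1 π + ENNReal.ofReal (Real.log (2 / ε)))
                  / ENNReal.ofReal lam)} := by
  refine (ofReal_one_sub_le_measure_lintegral_exp_deviation_le P hmeas hbound π hn lam
    hε.1).trans (measure_mono fun ω hω => ?_)
  rw [Set.mem_ofPred_eq]
  refine le_iInf fun ρ => ?_
  obtain ⟨ρ, hρ⟩ := ρ
  have hε0 := hε.1
  have hn' : (0 : ℝ) < n := by exact_mod_cast hn
  have hL : 0 ≤ Real.log (2 / ε) :=
    Real.log_nonneg (by rw [le_div_iff₀ hε0]; linarith [hε.2])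
  have hR := measurable_risk P hmeas
  have hr : Measurable fun θ => empRisk f ℓ n ω θ :=
    (measurable_empRisk hmeas n).comp measurable_prodMk_left
  have hRb := risk_mem_Icc P f hbound
  have hrb := empRisk_mem_Icc f hbound hn ω
  have hlog (s : ℝ) (hs : s ∈ ({lam, -lam} : Set ℝ)) :
      Real.log (∫ θ, Real.exp (s * (risk P f ℓ θ - empRisk f ℓ n ω θ)) ∂π) ≤
        Real.log (2 / ε) + lam ^ 2 * C ^ 2 / (8 * n) := by
    have hlog_eq : Real.log (2 / ε) + lam ^ 2 * C ^ 2 / (8 * n) =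
        Real.log (2 / ε * Real.exp (lam ^ 2 * C ^ 2 / (8 * n))) := by
      rw [Real.log_mul (by positivity) (Real.exp_pos _).ne', Real.log_exp]
    have hint : Integrable
        (fun θ => Real.exp (s * (risk P f ℓ θ - empRisk f ℓ n ω θ))) π :=
      ⟨((hR.sub hr).const_mul s).exp.aestronglyMeasurable, by
        rw [hasFiniteIntegral_iff_ofReal (ae_of_all _ fun _ => (Real.exp_pos _).le)]
        exact (hω s hs).trans_lt ENNReal.ofReal_lt_top⟩
    rw [hlog_eq]
    refine Real.log_le_log (integral_exp_pos hint) ?_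
    rw [← ENNReal.ofReal_le_ofReal_iff (by positivity),
      ofReal_integral_eq_lintegral_ofReal hint (ae_of_all _ fun _ => (Real.exp_pos _).le)]
    exact hω s hs
  by_cases hKL : ρ ≪ π ∧ Integrable (fun θ => Real.log ((ρ.rnDeriv π) θ).toReal) ρ
  swap
  · simp [KL, hKL, ENNReal.mul_top, ENNReal.top_div]
  have hmain := integral_tilted_le_of_log_integral_exp_le hKL.1 hKL.2 hR hr
    (fun θ => by rw [abs_of_nonneg (hRb θ).1]; exact (hRb θ).2)
    (fun θ => by rw [abs_of_nonneg (hrb θ).1]; exact (hrb θ).2)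
    (hlog lam (by simp)) (hlog (-lam) (by simp))
  have hKL0 : 0 ≤ ∫ θ, llr ρ π θ ∂ρ := by
    simpa using InformationTheory.integral_llr_add_sub_measure_univ_nonneg hKL.1 hKL.2
  have hofReal (ν : Measure Θ) [IsFiniteMeasure ν] :
      ∫⁻ θ, ENNReal.ofReal (risk P f ℓ θ) ∂ν = ENNReal.ofReal (∫ θ, risk P f ℓ θ ∂ν) :=
    (ofReal_integral_eq_lintegral_ofReal
      (.of_bound hR.aestronglyMeasurable C (ae_of_all _ fun θ => by
        rw [Real.norm_of_nonneg (hRb θ).1]; exact (hRb θ).2))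
      (ae_of_all _ fun θ => (hRb θ).1)).symm
  have hfin : IsFiniteMeasure (gibbs π f ℓ lam n ω) := by unfold gibbs; infer_instance
  have hKL_eq : KL ρ π = ENNReal.ofReal (∫ θ, llr ρ π θ ∂ρ) := if_pos hKL
  have hρ0 : 0 ≤ ∫ θ, risk P f ℓ θ ∂ρ := integral_nonneg fun θ => (hRb θ).1
  rw [hofReal, hofReal, hKL_eq, ← ENNReal.ofReal_add hKL0 hL,
    ← ENNReal.ofReal_ofNat 2, ← ENNReal.ofReal_mul zero_le_two,
    ← ENNReal.ofReal_div_of_pos hlam, ← ENNReal.ofReal_add hρ0 (by positivity),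
    ← ENNReal.ofReal_add (by positivity) (by positivity)]
  refine ENNReal.ofReal_le_ofReal (le_of_mul_le_mul_left (hmain.trans_eq ?_) hlam)
  field_simp
  ring
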